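/- If for each n ≥ 2 the data X_1, …, X_n are i.i.d. N(θ_0, 1) and t_w = (log n)^{-1}, then the adjusted criterion WBIC − ν̂(t_w) for model M_N satisfies lim_{n→∞} [ E{WBIC − ν̂(t_w)} − E{∑_{i=1}^n log p(X_i | θ_0)} + (1/2) log n ] = 0; that is, WBIC − ν̂(t_w) is an asymptotically unbiased estimator of the leading two terms E{log p(X^n | θ_0)} − (1/2) log n of the log marginal likelihood of M_N. -/

import Mathlib

open MeasureTheory ProbabilityTheory Real

/-- Normal likelihood density `p(x | θ) = (2π)^{-1/2} exp(−(x−θ)²/2)`. -/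
noncomputable def normalLik (x θ : ℝ) : ℝ :=
  (Real.sqrt (2 * Real.pi))⁻¹ * Real.exp (-(x - θ)^2 / 2)

/-- WBIC of model `M_N` for data `X`:
`WBIC = E^{t_w}[∑ᵢ log p(Xᵢ|θ)]` with `t_w = (log n)⁻¹`, the expectation being
under the tempered posterior `N(m_{t_w}, v_{t_w})`. -/
noncomputable def wbicN (n : ℕ) (m v : ℝ) (X : Fin n → ℝ) : ℝ :=
  let tw := (Real.log n)⁻¹
  let xbar := (∑ i, X i) / n
  let mt := (n * tw * xbar + m / v) / (n * tw + 1 / v)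
  let vt := (n * tw + 1 / v)⁻¹
  ∫ θ, (∑ i, Real.log (normalLik (X i) θ)) ∂(gaussianReal mt vt.toNNReal)

/-- Estimated singular fluctuation `ν̂(t) = (t/2)∑ᵢ V^t[log p(Xᵢ|θ)]` of model
`M_N`, the variances being taken under the tempered posterior `N(m_t, v_t)`. -/
noncomputable def nuHat (n : ℕ) (m v t : ℝ) (X : Fin n → ℝ) : ℝ :=
  let xbar := (∑ i, X i) / n
  let mt := (n * t * xbar + m / v) / (n * t + 1 / v)
  let vt := (n * t + 1 / v)⁻¹
  (t / 2) * ∑ i,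
    ((∫ θ, (Real.log (normalLik (X i) θ))^2 ∂(gaussianReal mt vt.toNNReal)) -
      (∫ θ, Real.log (normalLik (X i) θ) ∂(gaussianReal mt vt.toNNReal))^2)

open scoped NNReal

lemma integrable_pow_gaussianReal (μ : ℝ) (s : ℝ≥0) (k : ℕ) :
    Integrable (fun z : ℝ => z ^ k) (gaussianReal μ s) := by
  have h : (0 : ℝ) ∈ interior (integrableExpSet (fun z : ℝ => z) (gaussianReal μ s)) := by
    simp [integrableExpSet_fun_id_gaussianReal]
  exact integrable_pow_of_mem_interior_integrableExpSet h k

lemma iteratedDeriv_three_four_exp_mul_sq_zero (s : ℝ) :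
    iteratedDeriv 3 (fun t : ℝ => rexp (s * t ^ 2 / 2)) 0 = 0 ∧
      iteratedDeriv 4 (fun t : ℝ => rexp (s * t ^ 2 / 2)) 0 = 3 * s ^ 2 := by
  have hE (t : ℝ) : HasDerivAt (fun t : ℝ => rexp (s * t ^ 2 / 2))
      (s * t * rexp (s * t ^ 2 / 2)) t := by
    convert! ((((hasDerivAt_id t).pow 2).const_mul s).div_const 2).exp using 1
    simp
    ring
  have hP (p p' : ℝ → ℝ) (hp : ∀ t, HasDerivAt p (p' t) t) :
      deriv (fun t => p t * rexp (s * t ^ 2 / 2)) =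
        fun t => (p' t + s * t * p t) * rexp (s * t ^ 2 / 2) := by
    exact funext fun t => (((hp t).mul (hE t)).congr_deriv (by ring)).deriv
  have h1 : deriv (fun t : ℝ => rexp (s * t ^ 2 / 2)) =
      fun t => (s * t) * rexp (s * t ^ 2 / 2) := funext fun t => (hE t).deriv
  have h2 := hP (fun t => s * t) (fun _ => s) fun t => by
    simpa using (hasDerivAt_id t).const_mul s
  have h3 := hP (fun t => s + s * t * (s * t)) (fun t => 2 * s ^ 2 * t) fun t => by
    have := (hasDerivAt_id t).const_mul s
    convert! (this.mul this).const_add s using 1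
    simp
    ring
  have h4 := hP (fun t => 2 * s ^ 2 * t + s * t * (s + s * t * (s * t)))
      (fun t => 3 * s ^ 2 + 3 * s ^ 3 * t ^ 2) fun t => by
    have := (hasDerivAt_id t).const_mul s
    convert! ((hasDerivAt_id t).const_mul (2 * s ^ 2)).add
      (this.mul ((this.mul this).const_add s)) using 1
    simp
    ring
  simp only [iteratedDeriv_succ, iteratedDeriv_zero, h1, h2, h3, h4]
  simp

lemma integral_quartic_gaussianReal (s : ℝ≥0) (a₀ a₁ a₂ a₃ a₄ : ℝ) :
    ∫ z, (a₀ + a₁ * z + a₂ * z ^ 2 + a₃ * z ^ 3 + a₄ * z ^ 4) ∂(gaussianReal 0 s) =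
      a₀ + a₂ * s + 3 * a₄ * s ^ 2 := by
  have hint := integrable_pow_gaussianReal 0 s
  have h1i : Integrable (fun z : ℝ => z) (gaussianReal 0 s) := by simpa using hint 1
  have hmgf (k : ℕ) : ∫ z, z ^ k ∂(gaussianReal 0 s) =
      iteratedDeriv k (fun t : ℝ => rexp (s * t ^ 2 / 2)) 0 := by
    have h := iteratedDeriv_mgf_zero (X := id) (μ := gaussianReal 0 s)
      (by simp [integrableExpSet_id_gaussianReal]) k
    rw [mgf_id_gaussianReal] at h
    simpa using h.symm
  have h1 : ∫ z, z ∂(gaussianReal 0 s) = 0 := integral_id_gaussianReal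
  have h2 : ∫ z, z ^ 2 ∂(gaussianReal 0 s) = s := by
    rw [← variance_of_integral_eq_zero aemeasurable_id' h1, variance_fun_id_gaussianReal]
  have h3 := (hmgf 3).trans (iteratedDeriv_three_four_exp_mul_sq_zero s).1
  have h4 := (hmgf 4).trans (iteratedDeriv_three_four_exp_mul_sq_zero s).2
  have i1 := h1i.const_mul a₁
  have i2 := (hint 2).const_mul a₂
  have i3 := (hint 3).const_mul a₃
  have i4 := (hint 4).const_mul a₄
  have i0 := integrable_const (μ := gaussianReal 0 s) a₀
  have i01 : Integrable (fun z => a₀ + a₁ * z) (gaussianReal 0 s) := i0.add i1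
  have i02 : Integrable (fun z => a₀ + a₁ * z + a₂ * z ^ 2) (gaussianReal 0 s) := i01.add i2
  have i03 : Integrable (fun z => a₀ + a₁ * z + a₂ * z ^ 2 + a₃ * z ^ 3) (gaussianReal 0 s) :=
    i02.add i3
  rw [integral_add i03 i4, integral_add i02 i3, integral_add i01 i2, integral_add i0 i1,
    integral_const_mul a₁ fun z => z, h1]
  simp only [integral_const_mul, integral_const, h2, h3, h4, probReal_univ, smul_eq_mul]
  ring

lemma integral_comp_sub_gaussianReal (μ : ℝ) (s : ℝ≥0) (f : ℝ → ℝ) :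
    ∫ θ, f (θ - μ) ∂(gaussianReal μ s) = ∫ z, f z ∂(gaussianReal 0 s) := by
  have h := gaussianReal_map_sub_const (μ := μ) (v := s) μ
  rw [sub_self] at h
  rw [← h]
  exact ((MeasurableEquiv.subRight μ).measurableEmbedding.integral_map f).symm

lemma log_normalLik (x θ : ℝ) :
    Real.log (normalLik x θ) = -Real.log (√(2 * π)) - (x - θ) ^ 2 / 2 := by
  have h : √(2 * π) ≠ 0 := by positivity
  rw [normalLik, Real.log_mul (inv_ne_zero h) (exp_ne_zero _), Real.log_inv, Real.log_exp]
  ring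

lemma integrable_log_normalLik (x μ : ℝ) (s : ℝ≥0) :
    Integrable (fun θ => Real.log (normalLik x θ)) (gaussianReal μ s) := by
  have hint := integrable_pow_gaussianReal μ s
  have h := ((integrable_const (μ := gaussianReal μ s) (-Real.log (√(2 * π)) - x ^ 2 / 2)).add
    ((hint 1).const_mul x)).sub ((hint 2).const_mul (1 / 2))
  refine h.congr (ae_of_all _ fun θ => ?_)
  simp only [Pi.add_apply, Pi.sub_apply, log_normalLik]
  ring

lemma integral_log_normalLik (x μ : ℝ) (s : ℝ≥0) :
    ∫ θ, Real.log (normalLik x θ) ∂(gaussianReal μ s) =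
      -Real.log (√(2 * π)) - ((x - μ) ^ 2 + s) / 2 := by
  have h := integral_comp_sub_gaussianReal μ s
    fun z => -Real.log (√(2 * π)) - (x - μ) ^ 2 / 2 + (x - μ) * z + (-1 / 2) * z ^ 2
      + 0 * z ^ 3 + 0 * z ^ 4
  rw [integral_quartic_gaussianReal] at h
  convert h using 1
  · refine integral_congr_ae (ae_of_all _ fun θ => ?_)
    simp only [log_normalLik]
    ring
  · ring

lemma variance_log_normalLik (x μ : ℝ) (s : ℝ≥0) :
    ∫ θ, (Real.log (normalLik x θ)) ^ 2 ∂(gaussianReal μ s) -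
        (∫ θ, Real.log (normalLik x θ) ∂(gaussianReal μ s)) ^ 2 =
      s * (x - μ) ^ 2 + s ^ 2 / 2 := by
  set c := -Real.log (√(2 * π)) with hc
  set d := x - μ with hd
  have h := integral_comp_sub_gaussianReal μ s
    fun z => (c - d ^ 2 / 2) ^ 2 + 2 * (c - d ^ 2 / 2) * d * z
      + (d ^ 2 - (c - d ^ 2 / 2)) * z ^ 2 + (-d) * z ^ 3 + 1 / 4 * z ^ 4
  rw [integral_quartic_gaussianReal] at h
  have h' : ∫ θ, (Real.log (normalLik x θ)) ^ 2 ∂(gaussianReal μ s) =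
      (c - d ^ 2 / 2) ^ 2 + (d ^ 2 - (c - d ^ 2 / 2)) * s + 3 * (1 / 4) * s ^ 2 := by
    rw [← h]
    refine integral_congr_ae (ae_of_all _ fun θ => ?_)
    simp only [log_normalLik, hd, ← hc]
    ring
  rw [h', integral_log_normalLik, ← hc, ← hd]
  ring

lemma integral_sum_sq_sub_shrinkage {n : ℕ} (hn : n ≠ 0) (θ₀ a m : ℝ) :
    Integrable (fun X : Fin n → ℝ => ∑ i, (X i - (a * ((∑ j, X j) / n) + (1 - a) * m)) ^ 2)
        (Measure.pi fun _ : Fin n => gaussianReal θ₀ 1) ∧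
      ∫ X : Fin n → ℝ, ∑ i, (X i - (a * ((∑ j, X j) / n) + (1 - a) * m)) ^ 2
        ∂(Measure.pi fun _ : Fin n => gaussianReal θ₀ 1) =
      n - 1 + (1 - a) ^ 2 * (1 + n * (θ₀ - m) ^ 2) := by
  set P : Measure (Fin n → ℝ) := Measure.pi fun _ : Fin n => gaussianReal θ₀ 1 with hP
  have hn' : (n : ℝ) ≠ 0 := by exact_mod_cast hn
  have hY : MemLp (fun x : ℝ => x - θ₀) 2 (gaussianReal θ₀ 1) :=
    (memLp_id_gaussianReal 2).sub (memLp_const θ₀)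
  have hEY : ∫ x, (x - θ₀) ∂(gaussianReal θ₀ 1) = 0 := by
    rw [integral_comp_sub_gaussianReal θ₀ 1 fun z => z]
    exact integral_id_gaussianReal
  have hVY : Var[fun x : ℝ => x - θ₀; gaussianReal θ₀ 1] = 1 := by
    rw [variance_sub_const (X := fun x : ℝ => x) aestronglyMeasurable_id, variance_fun_id_gaussianReal]
    simp
  have hEY2 : ∫ x, (x - θ₀) ^ 2 ∂(gaussianReal θ₀ 1) = 1 := by
    rw [← hVY, variance_of_integral_eq_zero hY.aemeasurable hEY]
  have hYi (i : Fin n) : MemLp (fun X : Fin n → ℝ => X i - θ₀) 2 P :=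
    hY.comp_measurePreserving (measurePreserving_eval _ i)
  have hT : MemLp (fun X : Fin n → ℝ => ∑ i, (X i - θ₀)) 2 P :=
    memLp_finsetSum _ fun i _ => hYi i
  have hT1 : Integrable (fun X : Fin n → ℝ => ∑ i, (X i - θ₀)) P := hT.integrable one_le_two
  have hQi (i : Fin n) : Integrable (fun X : Fin n → ℝ => (X i - θ₀) ^ 2) P := (hYi i).integrable_sq
  have hQ : Integrable (fun X : Fin n → ℝ => ∑ i, (X i - θ₀) ^ 2) P :=
    integrable_finsetSum _ fun i _ => hQi i
  have hEQ : ∫ X : Fin n → ℝ, ∑ i, (X i - θ₀) ^ 2 ∂P = n := by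
    rw [integral_finsetSum _ fun i _ => hQi i]
    have (i : Fin n) : ∫ X : Fin n → ℝ, (X i - θ₀) ^ 2 ∂P = 1 := by
      rw [← hEY2]
      exact integral_comp_eval (μ := fun _ : Fin n => gaussianReal θ₀ 1)
        (f := fun x : ℝ => (x - θ₀) ^ 2) hY.integrable_sq.aestronglyMeasurable
    simp [this]
  have hET : ∫ X : Fin n → ℝ, ∑ i, (X i - θ₀) ∂P = 0 := by
    rw [integral_finsetSum _ fun i _ => (hYi i).integrable one_le_two]
    refine Finset.sum_eq_zero fun i _ => ?_
    rw [← hEY]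
    exact integral_comp_eval (μ := fun _ : Fin n => gaussianReal θ₀ 1)
      (f := fun x : ℝ => x - θ₀) hY.aestronglyMeasurable
  have hET2 : ∫ X : Fin n → ℝ, (∑ i, (X i - θ₀)) ^ 2 ∂P = n := by
    rw [← variance_of_integral_eq_zero hT.aemeasurable hET]
    have h := variance_sum_pi (μ := fun _ : Fin n => gaussianReal θ₀ 1)
      (X := fun _ x => x - θ₀) fun _ => hY
    have hsum : (∑ i : Fin n, fun ω : Fin n → ℝ => ω i - θ₀) = fun ω => ∑ i, (ω i - θ₀) := by
      ext ω
      simp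
    rw [hsum] at h
    rw [h]
    simp [hVY]
  have hexp (X : Fin n → ℝ) :
      ∑ i, (X i - (a * ((∑ j, X j) / n) + (1 - a) * m)) ^ 2 =
        ∑ i, (X i - θ₀) ^ 2 + (a ^ 2 - 2 * a) / n * (∑ i, (X i - θ₀)) ^ 2 +
          2 * (1 - a) ^ 2 * (θ₀ - m) * ∑ i, (X i - θ₀) + n * (1 - a) ^ 2 * (θ₀ - m) ^ 2 := by
    have hS : ∑ j, X j = ∑ j, (X j - θ₀) + n * θ₀ := by simp
    rw [hS]
    generalize hTdef : ∑ j, (X j - θ₀) = T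
    have (i : Fin n) : (X i - (a * ((T + n * θ₀) / n) + (1 - a) * m)) ^ 2 =
        (X i - θ₀) ^ 2 + 2 * ((1 - a) * (θ₀ - m) - a * T / n) * (X i - θ₀) +
          ((1 - a) * (θ₀ - m) - a * T / n) ^ 2 := by
      field_simp
      ring
    simp only [this, Finset.sum_add_distrib, ← Finset.mul_sum, hTdef, Finset.sum_const,
      Finset.card_univ, Fintype.card_fin, nsmul_eq_mul]
    field_simp
    ring
  simp only [hexp]
  have i1 := hT.integrable_sq.const_mul ((a ^ 2 - 2 * a) / n)
  have i2 := hT1.const_mul (2 * (1 - a) ^ 2 * (θ₀ - m))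
  have i3 := integrable_const (μ := P) (n * (1 - a) ^ 2 * (θ₀ - m) ^ 2)
  have i01 : Integrable (fun X : Fin n → ℝ =>
      ∑ i, (X i - θ₀) ^ 2 + (a ^ 2 - 2 * a) / n * (∑ i, (X i - θ₀)) ^ 2) P := hQ.add i1
  have i02 : Integrable (fun X : Fin n → ℝ =>
      ∑ i, (X i - θ₀) ^ 2 + (a ^ 2 - 2 * a) / n * (∑ i, (X i - θ₀)) ^ 2 +
        2 * (1 - a) ^ 2 * (θ₀ - m) * ∑ i, (X i - θ₀)) P := i01.add i2
  refine ⟨i02.add i3, ?_⟩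
  rw [integral_add i02 i3, integral_add i01 i2, integral_add hQ i1]
  simp only [integral_const_mul, integral_const, hEQ, hET, hET2, probReal_univ, smul_eq_mul]
  field_simp
  ring

lemma integral_wbicN_sub_nuHat {n : ℕ} (hn : n ≠ 0) (θ₀ m : ℝ) {v : ℝ} (hv : 0 < v) {s : ℝ}
    (hs : s = (n * (Real.log n)⁻¹ + 1 / v)⁻¹) :
    ∫ X, (wbicN n m v X - nuHat n m v (Real.log n)⁻¹ X)
        ∂(Measure.pi fun _ : Fin n => gaussianReal θ₀ 1) =
      -n * Real.log (√(2 * π)) - n * s / 2 - (Real.log n)⁻¹ / 2 * (n * (s ^ 2 / 2)) -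
        (1 + (Real.log n)⁻¹ * s) / 2 * (n - 1 + (s / v) ^ 2 * (1 + n * (θ₀ - m) ^ 2)) := by
  have hlog : 0 ≤ Real.log n := Real.log_natCast_nonneg n
  have hden : 0 < n * (Real.log n)⁻¹ + 1 / v := by positivity
  have hs0 : 0 < s := hs ▸ inv_pos.2 hden
  set t := (Real.log n)⁻¹ with ht
  have ha : 1 - n * t * s = s / v := by
    have h : s * (n * t + 1 / v) = 1 := by rw [hs, inv_mul_cancel₀ hden.ne']
    linear_combination -h
  have hmean (y : ℝ) : (n * t * y + m / v) / (n * t + 1 / v) =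
      (n * t * s) * y + (1 - n * t * s) * m := by
    rw [ha, div_eq_mul_inv, ← hs]
    ring
  obtain ⟨hi, hI⟩ := integral_sum_sq_sub_shrinkage hn θ₀ (n * t * s) m
  rw [ha] at hI
  have hpt (X : Fin n → ℝ) : wbicN n m v X - nuHat n m v t X =
      (-n * Real.log (√(2 * π)) - n * s / 2 - t / 2 * (n * (s ^ 2 / 2))) -
        (1 + t * s) / 2 *
          ∑ i, (X i - ((n * t * s) * ((∑ j, X j) / n) + (1 - n * t * s) * m)) ^ 2 := by
    simp only [wbicN, nuHat, ← ht, ← hs, hmean]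
    rw [integral_finsetSum _ fun i _ => integrable_log_normalLik _ _ _]
    simp only [variance_log_normalLik]
    simp only [integral_log_normalLik, Real.coe_toNNReal s hs0.le,
      add_div, Finset.sum_add_distrib, Finset.sum_sub_distrib, ← Finset.mul_sum, Finset.sum_const,
      Finset.card_univ, Fintype.card_fin, nsmul_eq_mul, ← Finset.sum_div]
    ring
  simp only [hpt]
  rw [integral_sub (integrable_const _) (hi.const_mul _), integral_const_mul, ha, hI]
  simp

lemma integral_sum_log_normalLik {n : ℕ} (hn : n ≠ 0) (θ₀ : ℝ) :
    ∫ X, (∑ i, Real.log (normalLik (X i) θ₀))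
        ∂(Measure.pi fun _ : Fin n => gaussianReal θ₀ 1) =
      -n * Real.log (√(2 * π)) - n / 2 := by
  obtain ⟨hi, hI⟩ := integral_sum_sq_sub_shrinkage hn θ₀ 0 θ₀
  simp only [zero_mul, sub_zero, one_mul, zero_add] at hi hI
  have hpt (X : Fin n → ℝ) : ∑ i, Real.log (normalLik (X i) θ₀) =
      -n * Real.log (√(2 * π)) - 1 / 2 * ∑ i, (X i - θ₀) ^ 2 := by
    simp only [log_normalLik, Finset.sum_sub_distrib, Finset.sum_const, Finset.card_univ,
      Fintype.card_fin, nsmul_eq_mul, ← Finset.sum_div]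
    ring
  simp only [hpt]
  rw [integral_sub (integrable_const _) (hi.const_mul _), integral_const_mul (1 / 2 : ℝ), hI]
  simp
  ring

/-- if for each `n ≥ 2` the data are i.i.d. `N(θ₀, 1)` and
`t_w = (log n)⁻¹`, then
`E{WBIC − ν̂(t_w)} − E{∑ᵢ log p(Xᵢ|θ₀)} + (1/2)log n → 0`; i.e.
`WBIC − ν̂(t_w)` is an asymptotically unbiased estimator of the leading two
terms `E{log p(Xⁿ|θ₀)} − (1/2)log n` of the log marginal likelihood of `M_N`. -/
theorem normal_adjusted_wbic_asymptotically_unbiased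
    (θ₀ m v : ℝ) (hv : 0 < v) :
    Filter.Tendsto
      (fun n : ℕ =>
        (∫ X, (wbicN n m v X - nuHat n m v (Real.log n)⁻¹ X)
            ∂(Measure.pi fun _ : Fin n => gaussianReal θ₀ 1)) -
          (∫ X, (∑ i, Real.log (normalLik (X i) θ₀))
            ∂(Measure.pi fun _ : Fin n => gaussianReal θ₀ 1)) +
          (1 / 2) * Real.log n)
      Filter.atTop (nhds 0) := by
  have hnat : Filter.Tendsto (fun n : ℕ => (n : ℝ)) Filter.atTop Filter.atTop :=
    tendsto_natCast_atTop_atTop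
  have hw : Filter.Tendsto (fun n : ℕ => Real.log n ^ 2 / n) Filter.atTop (nhds 0) := by
    simpa [Function.comp_def] using (tendsto_pow_log_div_mul_add_atTop 1 0 2 one_ne_zero).comp hnat
  have hε : Filter.Tendsto (fun n : ℕ => Real.log n / n) Filter.atTop (nhds 0) := by
    simpa [Function.comp_def] using (tendsto_pow_log_div_mul_add_atTop 1 0 1 one_ne_zero).comp hnat
  have hu : Filter.Tendsto (fun n : ℕ => (n : ℝ)⁻¹) Filter.atTop (nhds 0) :=
    tendsto_inv_atTop_zero.comp hnat
  have hq : Filter.Tendsto (fun n : ℕ => v / (v + Real.log n / n)) Filter.atTop (nhds 1) := by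
    have h := (tendsto_const_nhds (x := v)).div (hε.const_add v) (by simpa using hv.ne')
    simpa [hv.ne', Pi.div_def] using h
  let g : ℝ × ℝ × ℝ × ℝ → ℝ := fun ⟨w, ε, u, q⟩ =>
    w * q / (2 * v) - ε * q ^ 2 / 4 + 1 / 2 - (q - u * q) / 2 -
      (1 + u * q) / 2 * ((ε ^ 2 * q ^ 2 + w * q ^ 2 * (θ₀ - m) ^ 2) / v ^ 2)
  have hg : Continuous g := by fun_prop
  have hlim := (hg.tendsto (0, 0, 0, 1)).comp
    (hw.prodMk_nhds (hε.prodMk_nhds (hu.prodMk_nhds hq)))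
  have hg0 : g (0, 0, 0, 1) = 0 := by norm_num [g]
  rw [hg0] at hlim
  refine hlim.congr' ?_
  filter_upwards [Filter.eventually_ge_atTop 2] with n hn
  have hn0 : n ≠ 0 := by omega
  have hnpos : (0 : ℝ) < n := by exact_mod_cast Nat.pos_of_ne_zero hn0
  have hL : 0 < Real.log n := Real.log_pos (by exact_mod_cast hn)
  rw [integral_wbicN_sub_nuHat hn0 θ₀ m hv rfl, integral_sum_log_normalLik hn0]
  simp only [Function.comp_apply, g]
  generalize Real.log n = L at hL
  generalize (n : ℝ) = N at hnpos
  have hpos : 0 < v * N + L := by positivity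
  have hs : (N * L⁻¹ + 1 / v)⁻¹ = L * v / (v * N + L) := by
    field_simp
  have hq' : v / (v + L / N) = v * N / (v * N + L) := by
    field_simp
  rw [hs, hq']
  field_simp
  ring
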